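/- arXiv:1606.05539 — 3 statements merged into one kernel-verified Lean document; each statement's English description precedes it below -/
import Mathlib

section
/- Let f : X → Y be a coarse equivalence between pseudo-metric spaces which are both large-scale geodesic. Then f is a quasi-isometry. -/
section Defs

variable {X Y : Type*} [PseudoMetricSpace X] [PseudoMetricSpace Y]

/-- Coarsely Lipschitz map. -/
def CoarselyLipschitz (f : X → Y) : Prop :=
  ∃ Φ : ℝ → ℝ, Monotone Φ ∧ ∀ x x' : X, dist (f x) (f x') ≤ Φ (dist x x')

/-- Coarsely expansive map. -/
def CoarselyExpansive (f : X → Y) : Prop :=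
  ∃ Φ : ℝ → ℝ, Monotone Φ ∧ Filter.Tendsto Φ Filter.atTop Filter.atTop ∧
    ∀ x x' : X, Φ (dist x x') ≤ dist (f x) (f x')

/-- Essentially surjective map. -/
def EssentiallySurjective (f : X → Y) : Prop :=
  ∃ C : ℝ, ∀ y : Y, ∃ x : X, dist y (f x) ≤ C

/-- Coarse equivalence. -/
def CoarseEquivalence (f : X → Y) : Prop :=
  CoarselyLipschitz f ∧ CoarselyExpansive f ∧ EssentiallySurjective f

/-- Large-scale Lipschitz map. -/
def LargeScaleLipschitz (f : X → Y) : Prop :=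
  ∃ a b : ℝ, 0 < a ∧ 0 ≤ b ∧ ∀ x x' : X, dist (f x) (f x') ≤ a * dist x x' + b

/-- Large-scale expansive map. -/
def LargeScaleExpansive (f : X → Y) : Prop :=
  ∃ a b : ℝ, 0 < a ∧ 0 ≤ b ∧ ∀ x x' : X, a * dist x x' - b ≤ dist (f x) (f x')

/-- Quasi-isometry. -/
def QuasiIsometry (f : X → Y) : Prop :=
  LargeScaleLipschitz f ∧ LargeScaleExpansive f ∧ EssentiallySurjective f

end Defs

/-- Large-scale geodesic pseudo-metric space. -/
def LargeScaleGeodesic (X : Type*) [PseudoMetricSpace X] : Prop :=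
  ∃ a b c : ℝ, 0 < a ∧ 0 ≤ b ∧ 0 < c ∧ ∀ x y : X, ∃ n : ℕ,
    (n : ℝ) ≤ a * dist x y + b ∧
    ∃ p : ℕ → X, p 0 = x ∧ p n = y ∧ ∀ i < n, dist (p i) (p (i + 1)) ≤ c

lemma chain_lipschitz {X Y : Type*} [PseudoMetricSpace X] [PseudoMetricSpace Y] (g : X → Y)
    (hX : LargeScaleGeodesic X)
    (H : ∀ c : ℝ, ∃ K : ℝ, ∀ x x' : X, dist x x' ≤ c → dist (g x) (g x') ≤ K) :
    LargeScaleLipschitz g := by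
  obtain ⟨a, b, c, ha, hb, hc, h⟩ := hX
  obtain ⟨K, hK⟩ := H c
  have hL : 0 < max K 1 := lt_of_lt_of_le one_pos (le_max_right _ _)
  refine ⟨max K 1 * a, max K 1 * b, by positivity, by positivity, fun x x' => ?_⟩
  obtain ⟨n, hn, p, rfl, rfl, hp⟩ := h x x'
  have h1 : dist (g (p 0)) (g (p n)) ≤ ∑ i ∈ Finset.range n, max K 1 :=
    dist_le_range_sum_of_dist_le (f := fun i => g (p i)) n
      (fun {i} hi => (hK _ _ (hp i hi)).trans (le_max_left _ _))
  simp only [Finset.sum_const, Finset.card_range, nsmul_eq_mul] at h1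
  nlinarith [mul_le_mul_of_nonneg_left hn hL.le]

/-- a coarse equivalence between large-scale geodesic pseudo-metric
spaces is a quasi-isometry. -/
theorem quasiIsometry_of_coarseEquivalence_of_largeScaleGeodesic
    {X Y : Type*} [PseudoMetricSpace X] [PseudoMetricSpace Y]
    (hX : LargeScaleGeodesic X) (hY : LargeScaleGeodesic Y)
    (f : X → Y) (hf : CoarseEquivalence f) :
    QuasiIsometry f := by
  obtain ⟨⟨Φ, hΦ, h1⟩, ⟨Ψ, hΨ, hT, h2⟩, C, hC⟩ := hf
  refine ⟨chain_lipschitz f hX fun c => ⟨Φ c, fun x x' h => (h1 x x').trans (hΦ h)⟩, ?_, C, hC⟩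
  have key : ∀ c : ℝ, ∃ K : ℝ, ∀ x x' : X, dist (f x) (f x') ≤ c → dist x x' ≤ K := by
    intro c
    obtain ⟨M, hM⟩ := (hT.eventually_gt_atTop c).exists
    refine ⟨M, fun x x' h => ?_⟩
    by_contra hlt
    have := hΨ (not_le.1 hlt).le
    linarith [h2 x x']
  choose g hg using hC
  have hgl : LargeScaleLipschitz g := by
    refine chain_lipschitz g hY fun c => ?_
    obtain ⟨K, hK⟩ := key (C + c + C)
    refine ⟨K, fun y y' h => hK _ _ ?_⟩
    have := dist_triangle4 (f (g y)) y y' (f (g y'))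
    rw [dist_comm (f (g y)) y] at this
    linarith [hg y, hg y']
  obtain ⟨a, b, ha, hb, hab⟩ := hgl
  obtain ⟨K, hK⟩ := key C
  refine ⟨a⁻¹, a⁻¹ * (max K 0 + b + max K 0), by positivity, by positivity, fun x x' => ?_⟩
  have e1 := (hK _ _ (hg (f x))).trans (le_max_left K 0)
  have e2 := (hK _ _ (hg (f x'))).trans (le_max_left K 0)
  have e3 := dist_triangle4 x (g (f x)) (g (f x')) x'
  rw [dist_comm (g (f x')) x'] at e3
  have e4 := hab (f x) (f x')
  rw [← mul_sub, inv_mul_le_iff₀ ha]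
  linarith
end

section
/- A pseudo-metric space X is coarsely ultrametric if and only if X is coarsely equivalent to an ultrametric space (a metric space whose distance satisfies d(x,z) ≤ max(d(x,y), d(y,z)) for all x,y,z). -/
/-- A pseudo-metric space is coarsely ultrametric if, for every `r ≥ 0`, the
equivalence relation generated by "being at distance at most `r`" has all its
classes of bounded diameter. -/
def CoarselyUltrametric (X : Type*) [PseudoMetricSpace X] : Prop :=
  ∀ r : ℝ, 0 ≤ r → ∃ C : ℝ, ∀ x y : X,
    Relation.EqvGen (fun a b => dist a b ≤ r) x y → dist x y ≤ C

/-- The least integer scale at which `x` and `y` are chain-connected. -/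
noncomputable def chainScale {X : Type*} [PseudoMetricSpace X] (x y : X) : ℕ :=
  sInf {n : ℕ | Relation.EqvGen (fun a b : X => dist a b ≤ (n : ℝ)) x y}

lemma chainScale_mem {X : Type*} [PseudoMetricSpace X] (x y : X) :
    Relation.EqvGen (fun a b : X => dist a b ≤ (chainScale x y : ℝ)) x y := by
  have h : {n : ℕ | Relation.EqvGen (fun a b : X => dist a b ≤ (n : ℝ)) x y}.Nonempty :=
    ⟨⌈dist x y⌉₊, Relation.EqvGen.rel _ _ (Nat.le_ceil _)⟩
  exact Nat.sInf_mem h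

lemma chainScale_le {X : Type*} [PseudoMetricSpace X] {x y : X} {n : ℕ}
    (h : Relation.EqvGen (fun a b : X => dist a b ≤ (n : ℝ)) x y) : chainScale x y ≤ n :=
  Nat.sInf_le h

lemma chainScale_comm {X : Type*} [PseudoMetricSpace X] (x y : X) :
    chainScale x y = chainScale y x :=
  le_antisymm (chainScale_le (Relation.EqvGen.symm _ _ (chainScale_mem y x)))
    (chainScale_le (Relation.EqvGen.symm _ _ (chainScale_mem x y)))

lemma chainScale_ultra {X : Type*} [PseudoMetricSpace X] (x y z : X) :
    chainScale x z ≤ max (chainScale x y) (chainScale y z) := by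
  apply chainScale_le
  refine Relation.EqvGen.trans _ y _ ?_ ?_
  · refine Relation.EqvGen.mono ?_ _ _ (chainScale_mem x y)
    intro a b h
    exact h.trans (by exact_mod_cast le_max_left _ _)
  · refine Relation.EqvGen.mono ?_ _ _ (chainScale_mem y z)
    intro a b h
    exact h.trans (by exact_mod_cast le_max_right _ _)

open Classical in
/-- The integer-valued ultrametric. -/
noncomputable def chainDist {X : Type*} [PseudoMetricSpace X] (x y : X) : ℕ :=
  if x = y then 0 else chainScale x y + 1

lemma chainDist_ultra {X : Type*} [PseudoMetricSpace X] (x y z : X) :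
    chainDist x z ≤ max (chainDist x y) (chainDist y z) := by
  have := chainScale_ultra x y z
  unfold chainDist
  by_cases h1 : x = y
  · subst h1; simp
  by_cases h2 : y = z
  · subst h2; simp
  by_cases h3 : x = z
  · simp [h3]
  simp only [h1, h2, h3, if_false]
  omega

/-- The ultrametric space structure on the underlying set. -/
noncomputable abbrev chainMetric (X : Type*) [PseudoMetricSpace X] : MetricSpace X where
  dist x y := (chainDist x y : ℝ)
  dist_self x := by simp [chainDist]
  dist_comm x y := by
    by_cases h : x = y
    · rw [h]
    · simp only [chainDist, chainScale_comm x y, h, Ne.symm h, if_false]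
  dist_triangle x y z := by
    have := chainDist_ultra x y z
    have h : chainDist x z ≤ chainDist x y + chainDist y z := by omega
    exact_mod_cast h
  eq_of_dist_eq_zero := by
    intro x y h
    by_contra hne
    have h' : chainDist x y = 0 := by exact_mod_cast h
    simp [chainDist, hne] at h'

/-- a pseudo-metric space is coarsely ultrametric if and only if it is
coarsely equivalent to an ultrametric space. -/
theorem coarselyUltrametric_iff_coarselyEquivalent_to_ultrametric
    {X : Type u} [PseudoMetricSpace X] :
    CoarselyUltrametric X ↔
      ∃ (Y : Type u) (m : MetricSpace Y),
        letI := m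
        (∀ x y z : Y, dist x z ≤ max (dist x y) (dist y z)) ∧
          ∃ f : X → Y, CoarseEquivalence f := by
  constructor
  · intro hX
    refine ⟨X, chainMetric X, ?_, id, ?_, ?_, ?_⟩
    · intro x y z
      have := chainDist_ultra x y z
      change (chainDist x z : ℝ) ≤ max (chainDist x y : ℝ) (chainDist y z : ℝ)
      exact_mod_cast this
    · refine ⟨fun t => (⌈t⌉₊ : ℝ) + 1, ?_, ?_⟩
      · intro a b hab
        have := Nat.ceil_mono hab
        have h2 : (⌈a⌉₊ : ℝ) ≤ ⌈b⌉₊ := by exact_mod_cast this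
        simpa using h2
      · intro x y
        change (chainDist x y : ℝ) ≤ (⌈dist x y⌉₊ : ℝ) + 1
        have h : chainScale x y ≤ ⌈dist x y⌉₊ :=
          chainScale_le (Relation.EqvGen.rel _ _ (Nat.le_ceil _))
        have h2 : chainDist x y ≤ ⌈dist x y⌉₊ + 1 := by
          unfold chainDist
          split_ifs <;> omega
        exact_mod_cast h2
    · choose C hC using fun n : ℕ => hX (n : ℝ) (Nat.cast_nonneg n)
      let D : ℕ → ℝ := fun n => ∑ k ∈ Finset.range (n + 1), |C k| + n
      have hDmono : Monotone D := by
        refine monotone_nat_of_le_succ fun n => ?_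
        simp only [D]
        rw [Finset.sum_range_succ _ (n + 1)]
        push_cast
        have := abs_nonneg (C (n + 1))
        linarith
      have hDn : ∀ n : ℕ, (n : ℝ) ≤ D n := fun n => by
        have : 0 ≤ ∑ k ∈ Finset.range (n + 1), |C k| :=
          Finset.sum_nonneg fun k _ => abs_nonneg _
        simp only [D]
        linarith
      have hCD : ∀ n : ℕ, C n ≤ D n := fun n => by
        have h : |C n| ≤ ∑ k ∈ Finset.range (n + 1), |C k| :=
          Finset.single_le_sum (f := fun k => |C k|) (fun k _ => abs_nonneg _)
            (Finset.self_mem_range_succ n)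
        have h1 := le_abs_self (C n)
        have h2 : (0 : ℝ) ≤ n := Nat.cast_nonneg n
        simp only [D]
        linarith
      let F : ℝ → ℕ := fun t => sInf {n : ℕ | t ≤ D n}
      have hF : ∀ t, t ≤ D (F t) := fun t => by
        have h : {n : ℕ | t ≤ D n}.Nonempty := ⟨⌈t⌉₊, (Nat.le_ceil t).trans (hDn _)⟩
        exact Nat.sInf_mem h
      have hFle : ∀ t (n : ℕ), t ≤ D n → F t ≤ n := fun t n h => Nat.sInf_le h
      have hFmono : Monotone F := fun a b hab => hFle _ _ (hab.trans (hF b))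
      refine ⟨fun t => (F t : ℝ), fun a b hab => Nat.cast_le.2 (hFmono hab), ?_, ?_⟩
      · refine tendsto_natCast_atTop_atTop.comp
          (Filter.tendsto_atTop_atTop.2 fun n => ⟨D n + 1, fun t ht => ?_⟩)
        by_contra hlt
        have h1 := hDmono (not_le.1 hlt).le
        have h2 := hF t
        linarith
      · intro x y
        change (F (dist x y) : ℝ) ≤ (chainDist x y : ℝ)
        have h : F (dist x y) ≤ chainDist x y := by
          by_cases hxy : x = y
          · subst hxy
            refine (hFle _ 0 ?_).trans (Nat.zero_le _)
            rw [dist_self]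
            exact_mod_cast hDn 0
          · have h1 : F (dist x y) ≤ chainScale x y :=
              hFle _ _ ((hC _ x y (chainScale_mem x y)).trans (hCD _))
            simp only [chainDist, hxy, if_false]
            omega
        exact_mod_cast h
    · refine ⟨0, fun y => ⟨y, ?_⟩⟩
      change (chainDist y y : ℝ) ≤ 0
      simp [chainDist]
  · rintro ⟨Y, m, hu, f, ⟨P, hP, hPf⟩, ⟨Q, hQ, hQt, hQf⟩, -⟩ r hr
    have key : ∀ x y : X, Relation.EqvGen (fun a b => dist a b ≤ r) x y →
        dist (f x) (f y) ≤ max (P r) 0 := by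
      intro x y h
      induction h with
      | rel x y h => exact ((hPf x y).trans (hP h)).trans (le_max_left _ _)
      | refl x => rw [dist_self]; exact le_max_right _ _
      | symm x y _ ih => rw [dist_comm]; exact ih
      | trans x y z _ _ ih1 ih2 => exact (hu _ (f y) _).trans (max_le ih1 ih2)
    obtain ⟨T, hT⟩ := Filter.tendsto_atTop_atTop.1 hQt (max (P r) 0 + 1)
    refine ⟨T, fun x y h => ?_⟩
    by_contra hlt
    have h1 := hT _ (not_le.1 hlt).le
    have h2 := hQf x y
    have h3 := key x y h
    linarith
end

section
/- Let X and Y be coarsely equivalent uniformly locally finite pseudo-metric spaces. Then X is amenable if and only if Y is amenable. -/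
/-- A subset `s` of a pseudo-metric space has diameter at most `r`. -/
def HasDiamLE {X : Type*} [PseudoMetricSpace X] (s : Set X) (r : ℝ) : Prop :=
  ∀ x ∈ s, ∀ y ∈ s, dist x y ≤ r

/-- A pseudo-metric space is uniformly locally finite (ULF): for every `r` there is a
finite bound on the cardinality of subsets of diameter at most `r`. -/
def UniformlyLocallyFinite (X : Type*) [PseudoMetricSpace X] : Prop :=
  ∀ r : ℝ, ∃ N : ℕ, ∀ s : Set X, HasDiamLE s r → s.encard ≤ N

/-- `B_X(F,r)`: the set of points at distance at most `r` from `F`. -/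
def closedThickening' {X : Type*} [PseudoMetricSpace X] (F : Set X) (r : ℝ) : Set X :=
  {x : X | ∃ y ∈ F, dist x y ≤ r}

/-- A ULF pseudo-metric space is amenable if for all `ε > 0` and `r > 0` there is a
nonempty finite `F` with `#(B_X(F,r)) ≤ (1+ε)·#(F)`. -/
def MetricallyAmenable (X : Type*) [PseudoMetricSpace X] : Prop :=
  ∀ ε : ℝ, 0 < ε → ∀ r : ℝ, 0 < r → ∃ F : Set X, F.Finite ∧ F.Nonempty ∧
    ((closedThickening' F r).ncard : ℝ) ≤ (1 + ε) * (F.ncard : ℝ)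

theorem aux_count {A B : Type*} (S : Set A) (T : Set B) (hT : T.Finite) (h : A → B)
    (hST : ∀ a ∈ S, h a ∈ T) (N : ℕ)
    (hN : ∀ t, {a | a ∈ S ∧ h a = t}.encard ≤ N) :
    S.Finite ∧ S.ncard ≤ N * T.ncard := by
  classical
  have hfib : ∀ t, {a | a ∈ S ∧ h a = t}.Finite := fun t =>
    Set.finite_of_encard_le_coe (hN t)
  have hS : S.Finite := by
    refine (hT.biUnion (fun t _ => hfib t)).subset ?_
    intro a ha
    simp only [Set.mem_iUnion]
    exact ⟨h a, hST a ha, ha, rfl⟩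
  refine ⟨hS, ?_⟩
  rw [Set.ncard_eq_toFinset_card S hS, Set.ncard_eq_toFinset_card T hT]
  refine Finset.card_le_mul_card_image_of_maps_to (f := h) (by simpa using hST) N ?_
  intro t _
  have h1 := hN t
  rw [← (hfib t).cast_ncard_eq] at h1
  have h2 : {a | a ∈ S ∧ h a = t}.ncard ≤ N := by exact_mod_cast h1
  refine le_trans (le_of_eq ?_) h2
  rw [← Set.ncard_coe_finset]
  congr 1
  ext a
  simp

theorem aux_finite {X : Type*} [PseudoMetricSpace X] (hX : UniformlyLocallyFinite X)
    (F : Set X) (hF : F.Finite) (r : ℝ) : (closedThickening' F r).Finite := by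
  refine (hF.biUnion (t := fun y => {x | dist x y ≤ r}) (fun y _ => ?_)).subset ?_
  · obtain ⟨N, hN⟩ := hX (2 * r)
    refine Set.finite_of_encard_le_coe (hN _ ?_)
    intro a ha b hb
    have := dist_triangle_right a b y
    simp only [Set.mem_setOf_eq] at ha hb
    linarith
  · rintro x ⟨y, hy, hxy⟩
    simp only [Set.mem_iUnion]
    exact ⟨y, hy, hxy⟩

theorem aux_main {X Y : Type*} [PseudoMetricSpace X] [PseudoMetricSpace Y]
    (hX : UniformlyLocallyFinite X) (hY : UniformlyLocallyFinite Y)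
    (f : X → Y) (hf : ∀ s : ℝ, ∃ R : ℝ, ∀ x x', dist (f x) (f x') ≤ s → dist x x' ≤ R)
    (hs : EssentiallySurjective f) (hA : MetricallyAmenable X) : MetricallyAmenable Y := by
  intro ε hε r hr
  obtain ⟨C₀, hC₀⟩ := hs
  obtain ⟨C, hC0, hC⟩ : ∃ C : ℝ, 0 ≤ C ∧ ∀ y : Y, ∃ x : X, dist y (f x) ≤ C :=
    ⟨max C₀ 0, le_max_right _ _, fun y => (hC₀ y).imp fun x hx => hx.trans (le_max_left _ _)⟩
  choose g hg using hC
  obtain ⟨R₀, hR₀⟩ := hf 0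
  obtain ⟨M, hM⟩ := hX R₀
  obtain ⟨N, hN⟩ := hY (2 * C)
  obtain ⟨R₁, hR₁⟩ := hf (2 * C + r)
  have hK : (0 : ℝ) < N * M + 1 := by positivity
  obtain ⟨F, hFf, hFn, hF⟩ := hA (ε / (N * M + 1)) (by positivity) (max R₁ 1) (by positivity)
  set R := max R₁ 1
  have hBf := aux_finite hX F hFf R
  have hGf := aux_finite hY (f '' F) (hFf.image f) C
  have hFG : f '' F ⊆ closedThickening' (f '' F) C := fun y hy => ⟨y, hy, by simpa using hC0⟩
  refine ⟨closedThickening' (f '' F) C, hGf, (hFn.image f).mono hFG, ?_⟩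
  set G := closedThickening' (f '' F) C
  have hFB : F ⊆ closedThickening' F R := fun y hy =>
    ⟨y, hy, by rw [dist_self]; positivity⟩
  have c1 := (aux_count F (f '' F) (hFf.image f) f (fun a ha => ⟨a, ha, rfl⟩) M (by
    intro t
    refine hM _ ?_
    rintro a ⟨_, ha⟩ b ⟨_, hb⟩
    exact hR₀ a b (by rw [ha, hb, dist_self]))).2
  have c2 := (aux_count (closedThickening' G r \ G) (closedThickening' F R \ F) hBf.diff g (by
    rintro y ⟨⟨z, ⟨w, ⟨x, hx, rfl⟩, hzw⟩, hyz⟩, hyG⟩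
    refine ⟨⟨x, hx, ?_⟩, fun h => hyG ⟨f (g y), ⟨g y, h, rfl⟩, hg y⟩⟩
    refine (hR₁ _ _ ?_).trans (le_max_left _ _)
    have h1 := dist_triangle_left (f (g y)) (f x) y
    have h2 := dist_triangle y z (f x)
    have h3 := hg y
    linarith) N (by
    intro t
    refine hN _ ?_
    rintro a ⟨_, ha⟩ b ⟨_, hb⟩
    have h1 := hg a
    have h2 := hg b
    rw [ha] at h1
    rw [hb] at h2
    have := dist_triangle_right a b (f t)
    linarith)).2
  have c3 : (f '' F).ncard ≤ G.ncard := Set.ncard_le_ncard hFG hGf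
  have c4 := Set.ncard_diff_add_ncard_of_subset hFB hBf
  have c5 := Set.ncard_le_ncard_diff_add_ncard (closedThickening' G r) G hGf
  have d1 : (F.ncard : ℝ) ≤ M * G.ncard := by
    exact_mod_cast c1.trans (Nat.mul_le_mul_left M c3)
  have d2 : ((closedThickening' G r \ G).ncard : ℝ) ≤
      N * ((closedThickening' F R \ F).ncard : ℝ) := by exact_mod_cast c2
  have d4 : ((closedThickening' F R \ F).ncard : ℝ) + F.ncard =
      ((closedThickening' F R).ncard : ℝ) := by exact_mod_cast c4
  have d5 : ((closedThickening' G r).ncard : ℝ) ≤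
      ((closedThickening' G r \ G).ncard : ℝ) + G.ncard := by exact_mod_cast c5
  have d6 : ((closedThickening' F R \ F).ncard : ℝ) ≤ ε / (N * M + 1) * F.ncard := by linarith
  have d7 : (N : ℝ) * (ε / (N * M + 1) * (M * G.ncard)) ≤ ε * G.ncard := by
    have : (N : ℝ) * (ε / (N * M + 1) * (M * G.ncard)) =
        (N * M) / (N * M + 1) * (ε * G.ncard) := by ring
    rw [this]
    refine mul_le_of_le_one_left (by positivity) ?_
    rw [div_le_one hK]
    linarith
  have d8 : (N : ℝ) * ((closedThickening' F R \ F).ncard : ℝ) ≤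
      N * (ε / (N * M + 1) * (M * G.ncard)) := by
    refine mul_le_mul_of_nonneg_left (d6.trans ?_) (by positivity)
    exact mul_le_mul_of_nonneg_left d1 (by positivity)
  linarith

/-- amenability is invariant under coarse equivalence between uniformly
locally finite pseudo-metric spaces. -/
theorem amenable_iff_of_coarseEquivalence
    {X Y : Type*} [PseudoMetricSpace X] [PseudoMetricSpace Y]
    (hX : UniformlyLocallyFinite X) (hY : UniformlyLocallyFinite Y)
    (f : X → Y) (hf : CoarseEquivalence f) :
    MetricallyAmenable X ↔ MetricallyAmenable Y := by
  obtain ⟨⟨Φ, hΦ, hL⟩, ⟨Ψ, hΨ, hΨt, hE⟩, hs⟩ := hf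
  have hexp : ∀ s : ℝ, ∃ R : ℝ, ∀ x x', dist (f x) (f x') ≤ s → dist x x' ≤ R := by
    intro s
    obtain ⟨R, hR⟩ := (hΨt.eventually (Filter.eventually_gt_atTop s)).exists
    refine ⟨R, fun x x' h => ?_⟩
    by_contra hc
    have h1 := hΨ (not_le.mp hc).le
    have h2 := hE x x'
    linarith
  refine ⟨aux_main hX hY f hexp hs, ?_⟩
  obtain ⟨C, hC⟩ := hs
  choose g hg using hC
  refine aux_main hY hX g ?_ ?_
  · intro s
    refine ⟨Φ s + 2 * C, fun y y' h => ?_⟩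
    have h1 := hL (g y) (g y')
    have h2 := hΦ h
    have h3 := dist_triangle4_right y y' (f (g y)) (f (g y'))
    have h4 := hg y
    have h5 := hg y'
    linarith
  · obtain ⟨R, hR⟩ := hexp C
    exact ⟨R, fun x => ⟨f x, hR _ _ (hg (f x))⟩⟩
end
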